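/- Let k ≥ 3 be an odd integer and let D be a k-quasi-transitive digraph with a unique initial strong component C. Then at least one of the following holds: (1) every vertex of C is a (k+1)-king of D; (2) there exist vertices u_1, u_2, u_3 in C such that u_1 is a (k+1)-king of D, u_2 is a (k+2)-king of D, u_2 → u_1, d(u_2,u_3) = k+2, u_3 is a 4-king of D, and every vertex at distance k+2 from u_2 is a 4-king of D. -/

import Mathlib

variable {V : Type*}

/-- A directed path of length `n` from `u` to `v` in the digraph with arc relation `A`:
a sequence of `n + 1` pairwise distinct vertices, consecutive ones joined by arcs. -/
def HasPathN (A : V → V → Prop) (u v : V) (n : ℕ) : Prop :=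
  ∃ f : Fin (n + 1) → V, Function.Injective f ∧ f 0 = u ∧ f (Fin.last n) = v ∧
    ∀ i : Fin n, A (f i.castSucc) (f i.succ)

/-- The distance from `u` to `v`: the length of a shortest directed path from `u` to `v`,
`⊤` if there is no such path. -/
noncomputable def ddist (A : V → V → Prop) (u v : V) : ℕ∞ :=
  sInf {n : ℕ∞ | ∃ m : ℕ, n = (m : ℕ∞) ∧ HasPathN A u v m}

/-- `D` is `k`-quasi-transitive if for every directed path `(v_0, …, v_k)` of length `k`,
either `(v_0, v_k)` or `(v_k, v_0)` is an arc. -/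
def KQuasiTrans (A : V → V → Prop) (k : ℕ) : Prop :=
  ∀ u v : V, HasPathN A u v k → A u v ∨ A v u

/-- A vertex `v` is an `r`-king if every vertex is within distance `r` from `v`. -/
def IsRKing (A : V → V → Prop) (r : ℕ) (v : V) : Prop :=
  ∀ u : V, ddist A v u ≤ (r : ℕ∞)

/-- `u` reaches `v` by a directed path. -/
def Reaches (A : V → V → Prop) (u v : V) : Prop :=
  ∃ n : ℕ, HasPathN A u v n

/-- A strong component: the set of all vertices mutually reachable with some vertex. -/
def IsStrongComponent (A : V → V → Prop) (S : Set V) : Prop :=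
  ∃ v : V, S = {u | Reaches A u v ∧ Reaches A v u}

/-- An initial strong component: a strong component receiving no arcs from outside. -/
def IsInitialStrongComponent (A : V → V → Prop) (S : Set V) : Prop :=
  IsStrongComponent A S ∧ ∀ u v : V, u ∉ S → v ∈ S → ¬ A u v

/-- The out-degree of `v` in `D`. -/
noncomputable def outDeg (A : V → V → Prop) (v : V) : ℕ :=
  {u : V | A v u}.ncard

/-- The out-degree of `v` in the subdigraph of `D` induced by `C`. -/
noncomputable def outDegIn (A : V → V → Prop) (C : Set V) (v : V) : ℕ :=
  {u ∈ C | A v u}.ncard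

/-- The maximum out-degree of the subdigraph induced by `C`. -/
noncomputable def maxOutDegIn (A : V → V → Prop) (C : Set V) : ℕ :=
  sSup (outDegIn A C '' C)

/-- A path of length `n`, presented as a sequence indexed by `ℕ` of which only the first `n + 1`
terms matter. -/
def IsPathSeq (A : V → V → Prop) (p : ℕ → V) (n : ℕ) : Prop :=
  (∀ i < n, A (p i) (p (i + 1))) ∧ ∀ i ≤ n, ∀ j ≤ n, p i = p j → i = j

theorem IsPathSeq.hasPathN {A : V → V → Prop} {p : ℕ → V} {n : ℕ} (h : IsPathSeq A p n) :
    HasPathN A (p 0) (p n) n := by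
  refine ⟨fun i => p i, ?_, by simp, by simp, fun i => ?_⟩
  · intro i j hij
    exact Fin.ext (h.2 i (by omega) j (by omega) hij)
  · simpa using h.1 i i.2

theorem HasPathN.exists_isPathSeq {A : V → V → Prop} {u v : V} {n : ℕ} (h : HasPathN A u v n) :
    ∃ p : ℕ → V, IsPathSeq A p n ∧ p 0 = u ∧ p n = v := by
  obtain ⟨f, hf, h0, hn, hA⟩ := h
  refine ⟨fun i => if hi : i < n + 1 then f ⟨i, hi⟩ else u, ⟨fun i hi => ?_, fun i hi j hj hij => ?_⟩,
    ?_, ?_⟩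
  · have := hA ⟨i, hi⟩
    simpa [show i < n + 1 by omega, hi] using this
  · simp only [show i < n + 1 by omega, show j < n + 1 by omega, dite_true] at hij
    simpa using hf hij
  · simpa using h0
  · simpa [Fin.last] using hn

theorem IsPathSeq.segment {A : V → V → Prop} {p : ℕ → V} {n : ℕ} (h : IsPathSeq A p n)
    {i j : ℕ} (hij : i ≤ j) (hj : j ≤ n) : HasPathN A (p i) (p j) (j - i) := by
  have : IsPathSeq A (fun t => p (i + t)) (j - i) :=
    ⟨fun t ht => h.1 (i + t) (by omega), fun s hs t ht hst => by
      have := h.2 (i + s) (by omega) (i + t) (by omega) hst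
      omega⟩
  have := this.hasPathN
  simpa [Nat.add_sub_cancel' hij] using this

theorem HasPathN.cons_le {A : V → V → Prop} {u v z : V} {n : ℕ} (huv : A u v)
    (h : HasPathN A v z n) : ∃ m ≤ n + 1, HasPathN A u z m := by
  obtain ⟨p, hp, rfl, rfl⟩ := h.exists_isPathSeq
  by_cases hu : ∃ j ≤ n, p j = u
  · obtain ⟨j, hj, rfl⟩ := hu
    exact ⟨n - j, by omega, hp.segment hj le_rfl⟩
  · push Not at hu
    have : IsPathSeq A (fun i => Nat.casesOn i u p) (n + 1) := by
      refine ⟨fun i hi => ?_, fun i hi j hj hij => ?_⟩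
      · cases i with
        | zero => exact huv
        | succ i => exact hp.1 i (by omega)
      · cases i with
        | zero => cases j with
          | zero => rfl
          | succ j => exact absurd hij.symm (hu j (by omega))
        | succ i => cases j with
          | zero => exact absurd hij (hu i (by omega))
          | succ j => rw [hp.2 i (by omega) j (by omega) hij]
    exact ⟨n + 1, le_rfl, this.hasPathN⟩

theorem HasPathN.ddist_le {A : V → V → Prop} {u v : V} {n : ℕ} (h : HasPathN A u v n) :
    ddist A u v ≤ n :=
  sInf_le ⟨n, rfl, h⟩

theorem hasPathN_of_ddist_eq {A : V → V → Prop} {u v : V} {n : ℕ} (h : ddist A u v = n) :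
    HasPathN A u v n := by
  have hne : {n : ℕ∞ | ∃ m : ℕ, n = (m : ℕ∞) ∧ HasPathN A u v m}.Nonempty := by
    by_contra hne
    rw [Set.not_nonempty_iff_eq_empty] at hne
    rw [ddist, hne, sInf_empty] at h
    exact ENat.natCast_ne_top n h.symm
  obtain ⟨m, hm, hp⟩ := csInf_mem hne
  have : ((m : ℕ) : ℕ∞) = n := hm.symm.trans h
  rwa [← Nat.cast_injective this]

theorem reaches_iff_ddist_ne_top {A : V → V → Prop} {u v : V} :
    Reaches A u v ↔ ddist A u v ≠ ⊤ := by
  constructor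
  · rintro ⟨n, hn⟩ h
    have := hn.ddist_le
    rw [h] at this
    exact ENat.natCast_ne_top n (top_le_iff.mp this)
  · intro h
    obtain ⟨n, hn⟩ := ENat.ne_top_iff_exists.mp h
    exact ⟨n, hasPathN_of_ddist_eq hn.symm⟩

theorem ddist_le_succ_of_adj {A : V → V → Prop} {u v : V} (z : V) (h : A u v) :
    ddist A u z ≤ ddist A v z + 1 := by
  by_cases ht : ddist A v z = ⊤
  · simp [ht]
  · obtain ⟨n, hn⟩ := ENat.ne_top_iff_exists.mp ht
    obtain ⟨m, hm, hp⟩ := (hasPathN_of_ddist_eq hn.symm).cons_le h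
    rw [← hn]
    exact hp.ddist_le.trans (by exact_mod_cast hm)

theorem IsPathSeq.ddist_le_add {A : V → V → Prop} {p : ℕ → V} {n : ℕ} (h : IsPathSeq A p n)
    (z : V) {i : ℕ} (hi : i ≤ n) : ddist A (p 0) z ≤ i + ddist A (p i) z := by
  induction i with
  | zero => simp
  | succ i ih =>
    refine (ih (by omega)).trans ?_
    have := ddist_le_succ_of_adj z (h.1 i (by omega))
    calc (i : ℕ∞) + ddist A (p i) z ≤ i + (ddist A (p (i + 1)) z + 1) := by gcongr
      _ = ((i + 1 : ℕ) : ℕ∞) + ddist A (p (i + 1)) z := by push_cast; ring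

theorem ddist_triangle (A : V → V → Prop) (u v w : V) :
    ddist A u w ≤ ddist A u v + ddist A v w := by
  by_cases ht : ddist A u v = ⊤
  · simp [ht]
  · obtain ⟨n, hn⟩ := ENat.ne_top_iff_exists.mp ht
    obtain ⟨p, hp, rfl, rfl⟩ := (hasPathN_of_ddist_eq hn.symm).exists_isPathSeq
    rw [← hn]
    exact hp.ddist_le_add w le_rfl

theorem ddist_self (A : V → V → Prop) (u : V) : ddist A u u = 0 := by
  have : IsPathSeq A (fun _ => u) 0 := ⟨by simp, fun i hi j hj _ => by omega⟩
  simpa using this.hasPathN.ddist_le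

theorem Reaches.trans {A : V → V → Prop} {u v w : V} (h₁ : Reaches A u v) (h₂ : Reaches A v w) :
    Reaches A u w := by
  rw [reaches_iff_ddist_ne_top] at *
  exact ne_top_of_le_ne_top (WithTop.add_ne_top.mpr ⟨h₁, h₂⟩) (ddist_triangle A u v w)

theorem reaches_refl (A : V → V → Prop) (u : V) : Reaches A u u := by
  simp [reaches_iff_ddist_ne_top, ddist_self]

theorem reaches_of_adj {A : V → V → Prop} {u v : V} (h : A u v) : Reaches A u v := by
  rw [reaches_iff_ddist_ne_top]
  refine ne_top_of_le_ne_top ?_ (ddist_le_succ_of_adj v h)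
  simp [ddist_self]

theorem ddist_le_succ_of_adj_right {A : V → V → Prop} {v w : V} (u : V) (h : A v w) {n : ℕ}
    (hn : ddist A u v = n) : ddist A u w ≤ (n + 1 : ℕ) := by
  have h₁ := ddist_triangle A u v w
  have h₂ := ddist_le_succ_of_adj w h
  rw [ddist_self, zero_add] at h₂
  rw [hn] at h₁
  push_cast
  exact h₁.trans (by gcongr)

/-- A shortest path from `u` to `v`; its `i`-th vertex is at distance `i` from `u`. -/
theorem exists_geodesic {A : V → V → Prop} {u v : V} {n : ℕ} (h : ddist A u v = n) :
    ∃ p : ℕ → V, IsPathSeq A p n ∧ p 0 = u ∧ p n = v ∧ ∀ i ≤ n, ddist A u (p i) = i := by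
  obtain ⟨p, hp, rfl, rfl⟩ := (hasPathN_of_ddist_eq h).exists_isPathSeq
  refine ⟨p, hp, rfl, rfl, fun i hi => ?_⟩
  have h₁ := (hp.segment (Nat.zero_le i) hi).ddist_le
  have h₂ := (hp.segment hi le_rfl).ddist_le
  have h₃ := ddist_triangle A (p 0) (p i) (p n)
  obtain ⟨a, ha⟩ := ENat.ne_top_iff_exists.mp (ne_top_of_le_ne_top (ENat.natCast_ne_top _) h₁)
  obtain ⟨b, hb⟩ := ENat.ne_top_iff_exists.mp (ne_top_of_le_ne_top (ENat.natCast_ne_top _) h₂)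
  rw [h, ← ha, ← hb] at h₃
  rw [← ha] at h₁ ⊢
  rw [← hb] at h₂
  norm_cast at *
  omega

/-- A sequence of `k + 1` vertices with pairwise distinct distances from `u`, joined by arcs and
starting at distance `k + 2`, has an arc from its first vertex to its last one, provided the
latter is at distance at most `k` from `u`. -/
theorem KQuasiTrans.adj_of_dist_injOn {A : V → V → Prop} {k : ℕ} (hqt : KQuasiTrans A k) {u : V}
    (f : ℕ → V) (g : ℕ → ℕ) (hA : ∀ i < k, A (f i) (f (i + 1)))
    (hd : ∀ i ≤ k, ddist A u (f i) = g i) (hg : ∀ i ≤ k, ∀ j ≤ k, g i = g j → i = j)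
    (hlt : g k + 1 < g 0) : A (f 0) (f k) := by
  have hp : IsPathSeq A f k := ⟨hA, fun i hi j hj hij => hg i hi j hj (by
    have h₁ := hd i hi
    rw [hij, hd j hj] at h₁
    exact (Nat.cast_injective h₁).symm)⟩
  refine (hqt _ _ hp.hasPathN).resolve_right fun h => ?_
  have h₁ := ddist_le_succ_of_adj_right u h (hd k le_rfl)
  rw [hd 0 (Nat.zero_le k)] at h₁
  norm_cast at h₁
  omega

/-- For odd `k`, a vertex at distance `k + 2` from `u` dominates every vertex whose distance from
`u` is even and at most `k - 1`. -/
theorem KQuasiTrans.adj_of_ddist_even {A : V → V → Prop} {k : ℕ} (hqt : KQuasiTrans A k)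
    (hk : 3 ≤ k) {u w : V} (hw : ddist A u w = (k + 2 : ℕ)) (t : ℕ) :
    ∀ y s, s + 2 * t + 1 = k → ddist A u y = (s : ℕ) → A w y := by
  obtain ⟨x, hx, hx0, hxw, hxd⟩ := exists_geodesic hw
  have hku : A (x k) u := by
    have hp : IsPathSeq A x k :=
      ⟨fun i hi => hx.1 i (by omega), fun i hi j hj => hx.2 i (by omega) j (by omega)⟩
    have := (hqt _ _ hp.hasPathN).resolve_left fun h => by
      rw [hx0] at h
      have h₁ := ddist_le_succ_of_adj_right (n := 0) u h (by simp [ddist_self])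
      rw [hxd k (by omega)] at h₁
      norm_cast at h₁
      omega
    rwa [hx0] at this
  have hw2 : A w (x 2) := by
    have := (hqt _ _ (by simpa using hx.segment (show 2 ≤ k + 2 by omega) le_rfl)).resolve_left
      fun h => by
        have h₁ := ddist_le_succ_of_adj_right u h (hxd 2 (by omega))
        rw [hxw, hw] at h₁
        norm_cast at h₁
        omega
    rwa [hxw] at this
  have step : ∀ e s, 2 ≤ e → e ≤ k → s + 2 = e → A w (x e) → ∀ y, ddist A u y = (s : ℕ) →
      A w y := by
    intro e s he hek hse hwe y hy
    obtain ⟨p, hp, hp0, hpy, hpd⟩ := exists_geodesic hy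
    have := hqt.adj_of_dist_injOn (u := u)
      (fun i => if i = 0 then w else if i ≤ k - e + 1 then x (e + i - 1) else p (i - (k - e + 2)))
      (fun i => if i = 0 then k + 2 else if i ≤ k - e + 1 then e + i - 1 else i - (k - e + 2))
      ?_ ?_ ?_ ?_
    · simpa [show k ≠ 0 by omega, show ¬ k ≤ k - e + 1 by omega,
        show k - (k - e + 2) = s by omega, hpy] using this
    · intro i hi
      rcases Nat.eq_zero_or_pos i with rfl | hi0
      · simpa using hwe
      · rcases lt_trichotomy i (k - e + 1) with h | h | h
        · have := hx.1 (e + i - 1) (by omega)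
          simpa [show i ≠ 0 by omega, show i ≤ k - e + 1 by omega, show i + 1 ≤ k - e + 1 by omega,
            show i ≤ k - e by omega, show e + i - 1 + 1 = e + i by omega] using this
        · simpa [h, show e + (k - e) = k by omega, hp0] using hku
        · have := hp.1 (i - (k - e + 2)) (by omega)
          simpa [show i ≠ 0 by omega, show ¬ i ≤ k - e + 1 by omega, show ¬ i ≤ k - e by omega,
            show i + 1 - (k - e + 2) = i - (k - e + 2) + 1 by omega] using this
    · intro i hi
      split_ifs
      · exact hw
      · exact hxd _ (by omega)
      · exact hpd _ (by omega)
    · intro i hi j hj hij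
      split_ifs at hij <;> omega
    · split_ifs <;> omega
  have hwu : A w u := step 2 0 le_rfl (by omega) rfl hw2 u (by simp [ddist_self])
  induction t with
  | zero =>
    intro y s hs hy
    obtain ⟨p, hp, hp0, hpy, hpd⟩ := exists_geodesic hy
    have := hqt.adj_of_dist_injOn (u := u) (fun i => if i = 0 then w else p (i - 1))
      (fun i => if i = 0 then k + 2 else i - 1) ?_ ?_ ?_ ?_
    · simpa [show k ≠ 0 by omega, show k - 1 = s by omega, hpy] using this
    · intro i hi
      rcases Nat.eq_zero_or_pos i with rfl | hi0
      · simpa [hp0] using hwu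
      · have := hp.1 (i - 1) (by omega)
        simpa [show i ≠ 0 by omega, show i - 1 + 1 = i by omega] using this
    · intro i hi
      split_ifs
      · exact hw
      · exact hpd _ (by omega)
    · intro i hi j hj hij
      split_ifs at hij <;> omega
    · split_ifs <;> omega
  | succ t ih =>
    intro y s hs hy
    exact step (s + 2) s (by omega) (by omega) rfl
      (ih (x (s + 2)) (s + 2) (by omega) (hxd _ (by omega))) y hy

/-- For odd `k`, a vertex at distance `k + 2` from `u` is within distance `max 2 (l + 2 - k)` of
every vertex at distance `l` from `u`. -/
theorem KQuasiTrans.ddist_le_max {A : V → V → Prop} {k : ℕ} (hqt : KQuasiTrans A k)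
    (hk : 3 ≤ k) (hko : Odd k) {u w z : V} (hw : ddist A u w = (k + 2 : ℕ)) {l : ℕ}
    (hl : ddist A u z = l) : ddist A w z ≤ (max 2 (l + 2 - k) : ℕ) := by
  obtain ⟨p, hp, hp0, hpz, hpd⟩ := exists_geodesic hl
  obtain ⟨m, rfl⟩ := hko
  have key : ∀ t s, s + 2 * t + 1 = 2 * m + 1 → s ≤ l → ddist A w z ≤ (l - s + 1 : ℕ) := by
    intro t s hst hs
    have h₁ := hqt.adj_of_ddist_even hk hw t (p s) s hst (hpd s hs)
    have h₂ := ddist_le_succ_of_adj z h₁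
    have h₃ := (hp.segment hs le_rfl).ddist_le
    rw [hpz] at h₃
    push_cast [Nat.cast_add]
    exact h₂.trans (by gcongr; exact_mod_cast h₃)
  by_cases hlk : 2 * m ≤ l
  · exact (key 0 (2 * m) (by omega) hlk).trans (by norm_cast; omega)
  · exact (key (m - l / 2) (2 * (l / 2)) (by omega) (by omega)).trans (by norm_cast; omega)

/-- In a finite digraph with a unique initial strong component `C`, every vertex of `C` reaches
every vertex. -/
theorem reaches_of_unique_initial [Fintype V] {A : V → V → Prop} {C : Set V}
    (huniq : ∀ S : Set V, IsInitialStrongComponent A S → S = C) {c : V} (hc : c ∈ C) (v : V) :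
    Reaches A c v := by
  obtain ⟨u, hu, hmin⟩ := Set.exists_min_image {u | Reaches A u v}
    (fun u => {x | Reaches A x u}.ncard) (Set.toFinite _) ⟨v, reaches_refl A v⟩
  have hback : ∀ x, Reaches A x u → Reaches A u x := by
    intro x hx
    have hsub : {y | Reaches A y x} ⊆ {y | Reaches A y u} := fun y hy => Reaches.trans hy hx
    have heq := Set.eq_of_subset_of_ncard_le hsub (hmin x (hx.trans hu)) (Set.toFinite _)
    have hmem : u ∈ {y | Reaches A y u} := reaches_refl A u
    rwa [← heq] at hmem
  have hinit : IsInitialStrongComponent A {x | Reaches A x u ∧ Reaches A u x} := by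
    refine ⟨⟨u, rfl⟩, fun x y hx hy hxy => hx ?_⟩
    have hxu : Reaches A x u := (reaches_of_adj hxy).trans hy.1
    exact ⟨hxu, hback x hxu⟩
  rw [← huniq _ hinit] at hc
  exact hc.1.trans hu

theorem IsInitialStrongComponent.mem_of_reaches {A : V → V → Prop} {C : Set V}
    (hC : IsInitialStrongComponent A C) {u v : V} (h : Reaches A u v) (hv : v ∈ C) : u ∈ C := by
  obtain ⟨n, hn⟩ := h
  obtain ⟨p, hp, rfl, rfl⟩ := hn.exists_isPathSeq
  refine Nat.decreasingInduction (motive := fun i _ => p i ∈ C) (fun i hi hmem => ?_) hv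
    (Nat.zero_le n)
  by_contra hni
  exact hC.2 _ _ hni hmem (hp.1 i hi)

theorem not_isRKing_iff {A : V → V → Prop} {r : ℕ} {v : V} :
    ¬ IsRKing A r v ↔ ∃ z, ((r + 1 : ℕ) : ℕ∞) ≤ ddist A v z := by
  simp only [IsRKing, not_forall, not_le]
  refine exists_congr fun z => ?_
  push_cast
  exact (ENat.add_one_le_iff (ENat.natCast_ne_top r)).symm

/-- For odd `k`, some vertex of the unique initial strong component is a `(k + 1)`-king. -/
theorem KQuasiTrans.exists_isRKing [Fintype V] {A : V → V → Prop} {k : ℕ}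
    (hqt : KQuasiTrans A k) (hk : 3 ≤ k) (hko : Odd k) {C : Set V}
    (hC : IsInitialStrongComponent A C)
    (huniq : ∀ S : Set V, IsInitialStrongComponent A S → S = C) :
    ∃ c ∈ C, IsRKing A (k + 1) c := by
  classical
  have hex : ∃ r, ∃ c ∈ C, IsRKing A r c := by
    obtain ⟨v, hv⟩ := hC.1
    have hvC : v ∈ C := by
      rw [hv]
      exact ⟨reaches_refl A v, reaches_refl A v⟩
    choose f hf using fun z => reaches_of_unique_initial huniq hvC z
    refine ⟨Finset.univ.sup f, v, hvC, fun z => (hf z).ddist_le.trans ?_⟩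
    exact_mod_cast Finset.le_sup (Finset.mem_univ z)
  obtain ⟨u, huC, hu⟩ := Nat.find_spec hex
  have hmin := fun r => Nat.find_min hex (m := r)
  set m := Nat.find hex
  by_cases hm : m ≤ k + 1
  · exact ⟨u, huC, fun z => (hu z).trans (by exact_mod_cast hm)⟩
  exfalso
  have hnot : ¬ IsRKing A (m - 1) u := fun h => hmin (m - 1) (by omega) ⟨u, huC, h⟩
  obtain ⟨z, hz⟩ := not_isRKing_iff.mp hnot
  rw [show m - 1 + 1 = m by omega] at hz
  obtain ⟨x, -, -, -, hxd⟩ := exists_geodesic (le_antisymm (hu z) hz)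
  have hw := hxd (k + 2) (by omega)
  have hwu : A (x (k + 2)) u := by
    obtain ⟨j, hj⟩ := hko
    exact hqt.adj_of_ddist_even hk hw j u 0 (by omega) (by simp [ddist_self])
  refine hmin (m - 1) (by omega) ⟨x (k + 2), hC.mem_of_reaches (reaches_of_adj hwu) huC, fun y => ?_⟩
  have hy := hu y
  obtain ⟨l, hl⟩ := ENat.ne_top_iff_exists.mp (ne_top_of_le_ne_top (ENat.natCast_ne_top _) hy)
  rw [← hl] at hy
  norm_cast at hy
  refine (hqt.ddist_le_max hk hko hw hl.symm).trans ?_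
  norm_cast
  omega

/-- odd `k ≥ 3`, unique initial strong component `C`; either every vertex of
`C` is a `(k+1)`-king, or there are `u₁, u₂, u₃ ∈ C` with `u₁` a `(k+1)`-king, `u₂` a
`(k+2)`-king, `u₂ → u₁`, `d(u₂,u₃) = k+2`, `u₃` a `4`-king, and every vertex at distance
`k+2` from `u₂` a `4`-king. -/
theorem kqt_odd_structure
    [Fintype V] (A : V → V → Prop) (hloop : ∀ v : V, ¬ A v v)
    (k : ℕ) (hk : 3 ≤ k) (hko : Odd k) (hqt : KQuasiTrans A k)
    (C : Set V) (hC : IsInitialStrongComponent A C)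
    (huniq : ∀ S : Set V, IsInitialStrongComponent A S → S = C) :
    (∀ v ∈ C, IsRKing A (k + 1) v) ∨
      (∃ u₁ ∈ C, ∃ u₂ ∈ C, ∃ u₃ ∈ C,
        IsRKing A (k + 1) u₁ ∧ IsRKing A (k + 2) u₂ ∧ A u₂ u₁ ∧
        ddist A u₂ u₃ = ((k : ℕ∞) + 2) ∧ IsRKing A 4 u₃ ∧
        ∀ w : V, ddist A u₂ w = ((k : ℕ∞) + 2) → IsRKing A 4 w) := by
  classical
  by_cases hall : ∀ v ∈ C, IsRKing A (k + 1) v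
  · exact Or.inl hall
  right
  push Not at hall
  obtain ⟨v, hvC, hv⟩ := hall
  obtain ⟨c, hcC, hc⟩ := hqt.exists_isRKing hk hko hC huniq
  obtain ⟨n, hn⟩ := reaches_of_unique_initial huniq hvC c
  obtain ⟨p, hp, rfl, rfl⟩ := hn.exists_isPathSeq
  have hex : ∃ i, IsRKing A (k + 1) (p i) := ⟨n, hc⟩
  have hspec := Nat.find_spec hex
  have hmin := fun i => Nat.find_min hex (m := i)
  have hle : Nat.find hex ≤ n := Nat.find_min' hex hc
  have hne : Nat.find hex ≠ 0 := fun h => hv (h ▸ hspec)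
  obtain ⟨i, hi⟩ := Nat.exists_eq_succ_of_ne_zero hne
  rw [hi] at hspec hmin hle
  have hadj : A (p i) (p (i + 1)) := hp.1 i (by omega)
  have hmem : ∀ j ≤ n, p j ∈ C := fun j hj =>
    hC.mem_of_reaches ⟨_, hp.segment hj le_rfl⟩ hcC
  have hking : IsRKing A (k + 2) (p i) := fun z =>
    (ddist_le_succ_of_adj z hadj).trans (by
      have := hspec z
      calc ddist A (p (i + 1)) z + 1 ≤ ((k + 1 : ℕ) : ℕ∞) + 1 := by gcongr
        _ = ((k + 2 : ℕ) : ℕ∞) := by push_cast; ring)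
  obtain ⟨z, hz⟩ := not_isRKing_iff.mp (hmin i (by omega))
  have hdz : ddist A (p i) z = (k + 2 : ℕ) := le_antisymm (hking z) hz
  have hfour : ∀ w : V, ddist A (p i) w = ((k : ℕ∞) + 2) → IsRKing A 4 w := by
    intro w hw y
    have hy := hking y
    obtain ⟨l, hl⟩ := ENat.ne_top_iff_exists.mp (ne_top_of_le_ne_top (ENat.natCast_ne_top _) hy)
    rw [← hl] at hy
    norm_cast at hy
    refine (hqt.ddist_le_max hk hko (by exact_mod_cast hw) hl.symm).trans ?_
    norm_cast
    omega
  have hdz' : ddist A (p i) z = ((k : ℕ∞) + 2) := by exact_mod_cast hdz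
  have hzC : z ∈ C := by
    obtain ⟨j, hj⟩ := hko
    exact hC.mem_of_reaches (reaches_of_adj (hqt.adj_of_ddist_even hk hdz j (p i) 0 (by omega)
      (by simp [ddist_self]))) (hmem i (by omega))
  exact ⟨p (i + 1), hmem _ hle, p i, hmem i (by omega), z, hzC, hspec, hking, hadj, hdz',
    hfour z hdz', hfour⟩
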